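/- arXiv:1811.03025 — 4 statements merged into one kernel-verified Lean document; each statement's English description precedes it below -/
import Mathlib

section
/- The image of the complexified torus under Ψ is exactly the parabolic cylinder: Ψ(𝒯) = 𝒞, i.e. every z ∈ 𝒯 satisfies Ψ(z) ∈ 𝒞, and every w ∈ 𝒞 is of the form Ψ(z) for some z ∈ 𝒯. -/
/-- The complexified torus `𝒯` of radii `0 < r < R`. -/
def torusC (r R : ℝ) : Set (Fin 3 → ℂ) :=
  {z | (z 0 ^ 2 + z 1 ^ 2 + z 2 ^ 2 - ((R : ℂ) ^ 2 + (r : ℂ) ^ 2)) ^ 2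
      = 4 * (R : ℂ) ^ 2 * ((r : ℂ) ^ 2 - z 2 ^ 2)}

/-- The polynomial map `Ψ : ℂ³ → ℂ³`. -/
noncomputable def psiMap (r R : ℝ) (z : Fin 3 → ℂ) : Fin 3 → ℂ :=
  ![(z 0 ^ 2 + z 1 ^ 2 + z 2 ^ 2 + (R : ℂ) ^ 2 - (r : ℂ) ^ 2) / (2 * (R : ℂ)),
    z 0 ^ 2 + z 1 ^ 2, z 1 ^ 2]

/-- The parabolic cylinder `𝒞 = {w ∈ ℂ³ : w₁² = w₂}`. -/
def parabCyl : Set (Fin 3 → ℂ) := {w | w 0 ^ 2 = w 1}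

/-- `Ψ(𝒯) = 𝒞`. -/
theorem psi_image_torus_eq_cylinder (r R : ℝ) (hr : 0 < r) (hrR : r < R) :
    psiMap r R '' torusC r R = parabCyl := by
  have hR : (R : ℂ) ≠ 0 := by exact_mod_cast (hr.trans hrR).ne'
  apply Set.Subset.antisymm
  · rintro _ ⟨z, hz, rfl⟩
    simp only [torusC, Set.mem_ofPred_eq] at hz
    simp only [parabCyl, psiMap, Set.mem_ofPred_eq, Matrix.cons_val_zero, Matrix.cons_val_one]
    field_simp
    linear_combination hz
  · intro w hw
    simp only [parabCyl, Set.mem_ofPred_eq] at hw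
    obtain ⟨a, ha⟩ := IsAlgClosed.exists_pow_nat_eq (w 1 - w 2) two_pos
    obtain ⟨b, hb⟩ := IsAlgClosed.exists_pow_nat_eq (w 2) two_pos
    obtain ⟨c, hc⟩ :=
      IsAlgClosed.exists_pow_nat_eq (2 * R * w 0 - (R : ℂ) ^ 2 + (r : ℂ) ^ 2 - w 1) two_pos
    refine ⟨![a, b, c], ?_, ?_⟩
    · simp only [torusC, Set.mem_ofPred_eq, Matrix.cons_val]
      rw [ha, hb, hc]
      linear_combination 4 * (R : ℂ) ^ 2 * hw
    · ext i
      fin_cases i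
      · simp only [psiMap, Fin.zero_eta, Matrix.cons_val]
        rw [ha, hb, hc]
        field_simp
        ring
      · simp [psiMap, ha, hb]
      · simp [psiMap, hb]
end

section
/- The image of the real torus under Ψ is exactly E: Ψ(𝕋) = E. -/
/-- The real torus `𝕋 = 𝒯 ∩ ℝ³`, viewed inside `ℂ³`. -/
def torusR (r R : ℝ) : Set (Fin 3 → ℂ) :=
  torusC r R ∩ {z | ∀ i, (z i).im = 0}

/-- `E = {w ∈ ℝ³ : w₂ = w₁², 0 ≤ w₃ ≤ w₁², R−r ≤ w₁ ≤ R+r}`, viewed inside `ℂ³`. -/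
def Eset (r R : ℝ) : Set (Fin 3 → ℂ) :=
  {w | ∃ u v t : ℝ, w 0 = (u : ℂ) ∧ w 1 = (v : ℂ) ∧ w 2 = (t : ℂ) ∧
      v = u ^ 2 ∧ 0 ≤ t ∧ t ≤ u ^ 2 ∧ R - r ≤ u ∧ u ≤ R + r}

/-- On real points, `torusC` is the tube of radius `r` around the core circle, written in terms of
the first coordinate `u` of `psiMap`. -/
theorem torus_equation_iff {r R a b c u : ℝ} (hR : R ≠ 0)
    (hu : 2 * R * u = a ^ 2 + b ^ 2 + c ^ 2 + R ^ 2 - r ^ 2) :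
    (a ^ 2 + b ^ 2 + c ^ 2 - (R ^ 2 + r ^ 2)) ^ 2 = 4 * R ^ 2 * (r ^ 2 - c ^ 2) ↔
      (u - R) ^ 2 + c ^ 2 = r ^ 2 := by
  have h : a ^ 2 + b ^ 2 + c ^ 2 - (R ^ 2 + r ^ 2) = 2 * R * (u - R) := by linarith
  rw [h, show (2 * R * (u - R)) ^ 2 = 4 * R ^ 2 * (u - R) ^ 2 by ring,
    mul_right_inj' (by positivity), eq_sub_iff_add_eq]

/-- `Ψ(𝕋) = E`. -/
theorem psi_image_real_torus_eq_E (r R : ℝ) (hr : 0 < r) (hrR : r < R) :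
    psiMap r R '' torusR r R = Eset r R := by
  have hR : 0 < R := hr.trans hrR
  have hRC : (R : ℂ) ≠ 0 := by exact_mod_cast hR.ne'
  ext w
  constructor
  · rintro ⟨z, ⟨hz, him⟩, rfl⟩
    obtain ⟨x, rfl⟩ : ∃ x : Fin 3 → ℝ, z = fun i => (x i : ℂ) :=
      ⟨fun i => (z i).re, funext fun i => Complex.ext rfl (by simpa using him i)⟩
    obtain ⟨u, hu⟩ : ∃ u, u = (x 0 ^ 2 + x 1 ^ 2 + x 2 ^ 2 + R ^ 2 - r ^ 2) / (2 * R) := ⟨_, rfl⟩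
    have hu' : 2 * R * u = x 0 ^ 2 + x 1 ^ 2 + x 2 ^ 2 + R ^ 2 - r ^ 2 := by
      rw [hu]; field_simp
    have htube : (u - R) ^ 2 + x 2 ^ 2 = r ^ 2 :=
      (torus_equation_iff hR.ne' hu').1 <| by
        simp only [torusC, Set.mem_ofPred_eq] at hz
        exact_mod_cast hz
    have hsq : x 0 ^ 2 + x 1 ^ 2 = u ^ 2 := by linarith
    have hle : (u - R) ^ 2 ≤ r ^ 2 := by linarith [sq_nonneg (x 2)]
    obtain ⟨hl, hh⟩ := abs_le_of_sq_le_sq' hle hr.le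
    refine ⟨u, x 0 ^ 2 + x 1 ^ 2, x 1 ^ 2, ?_, ?_, ?_, hsq, sq_nonneg _, ?_, ?_, ?_⟩
    · simp [psiMap, hu]
    · simp [psiMap]
    · simp [psiMap]
    · linarith [sq_nonneg (x 0)]
    · linarith
    · linarith
  · rintro ⟨u, v, t, h0, h1, h2, rfl, ht, htu, hl, hh⟩
    have ha : √(u ^ 2 - t) ^ 2 = u ^ 2 - t := Real.sq_sqrt (by linarith)
    have hb : √t ^ 2 = t := Real.sq_sqrt ht
    have hc : √(r ^ 2 - (u - R) ^ 2) ^ 2 = r ^ 2 - (u - R) ^ 2 :=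
      Real.sq_sqrt (by nlinarith)
    have hu : 2 * R * u = √(u ^ 2 - t) ^ 2 + √t ^ 2 + √(r ^ 2 - (u - R) ^ 2) ^ 2 + R ^ 2 - r ^ 2 := by
      rw [ha, hb, hc]; ring
    have htorus := (torus_equation_iff hR.ne' hu).2 (by rw [hc]; ring)
    have haC : (√(u ^ 2 - t) : ℂ) ^ 2 = (u : ℂ) ^ 2 - t := by exact_mod_cast ha
    have hbC : (√t : ℂ) ^ 2 = t := by exact_mod_cast hb
    have huC : 2 * (R : ℂ) * u = (√(u ^ 2 - t) : ℂ) ^ 2 + (√t : ℂ) ^ 2 +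
        (√(r ^ 2 - (u - R) ^ 2) : ℂ) ^ 2 + (R : ℂ) ^ 2 - (r : ℂ) ^ 2 := by exact_mod_cast hu
    refine ⟨![(√(u ^ 2 - t) : ℂ), (√t : ℂ), (√(r ^ 2 - (u - R) ^ 2) : ℂ)], ⟨?_, ?_⟩, ?_⟩
    · simp only [torusC, Set.mem_ofPred_eq, Matrix.cons_val]
      exact_mod_cast htorus
    · intro i
      fin_cases i <;> simp
    · ext i
      fin_cases i
      · simp only [psiMap, Matrix.cons_val, Fin.zero_eta, h0]
        rw [← huC]
        field_simp
      · simp [psiMap, h1, haC, hbC]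
      · simp [psiMap, h2, hbC]
end

section
/- A segment in the trapezoid K joining the interior of an oblique edge to the interior of the left edge is not of maximal length among parallel chords of K: let a, b ∈ ℝ² with a ≠ b, where a lies on an open oblique edge of K (i.e. a₂ = r a₁ + R with −1 < a₁ < 1, or a₂ = −(r a₁ + R) with −1 < a₁ < 1), b lies on the open left edge (b₁ = −1, −(R−r) < b₂ < R−r), the closed segment [a,b] is contained in K, and [a,b] meets the boundary of K only in {a,b}. Then there exist a', b' ∈ K such that b' − a' is a positive scalar multiple of b − a, the closed segment [a',b'] is contained in K, and ‖b' − a'‖ > ‖b − a‖. -/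
/-- The trapezoid `K = {x ∈ ℝ² : −1 ≤ x₁ ≤ 1, −(rx₁+R) ≤ x₂ ≤ rx₁+R} ⊆ ℝ²`. -/
def trapKR (r R : ℝ) : Set (Fin 2 → ℝ) :=
  {x | -1 ≤ x 0 ∧ x 0 ≤ 1 ∧ -(r * x 0 + R) ≤ x 1 ∧ x 1 ≤ r * x 0 + R}

/-- The Euclidean norm of a vector in `ℝ²`. -/
noncomputable def eucNorm2 (x : Fin 2 → ℝ) : ℝ := Real.sqrt ((x 0) ^ 2 + (x 1) ^ 2)

theorem convex_trapKR (r R : ℝ) : Convex ℝ (trapKR r R) := by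
  rintro x ⟨hx₁, hx₂, hx₃, hx₄⟩ y ⟨hy₁, hy₂, hy₃, hy₄⟩ u v hu hv huv
  simp only [trapKR, Set.mem_ofPred_eq, Pi.add_apply, Pi.smul_apply, smul_eq_mul]
  obtain rfl : v = 1 - u := by linarith
  refine ⟨?_, ?_, ?_, ?_⟩ <;> nlinarith

theorem eucNorm2_smul (c : ℝ) (hc : 0 ≤ c) (x : Fin 2 → ℝ) :
    eucNorm2 (c • x) = c * eucNorm2 x := by
  have h : (c * x 0) ^ 2 + (c * x 1) ^ 2 = c ^ 2 * (x 0 ^ 2 + x 1 ^ 2) := by ring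
  simp only [eucNorm2, Pi.smul_apply, smul_eq_mul]
  rw [h, Real.sqrt_mul (sq_nonneg c), Real.sqrt_sq hc]

theorem eucNorm2_pos (x : Fin 2 → ℝ) (hx : x 0 ≠ 0) : 0 < eucNorm2 x :=
  Real.sqrt_pos.2 (by positivity)

/-- The segment from the oblique edge `x₂ = σ (r x₁ + R)`, `σ = ±1`, to the left edge is lengthened
by sliding its left endpoint away from that oblique edge. -/
theorem exists_longer_parallel_chord (r R σ : ℝ) (hr : 0 < r) (hrR : r < R)
    (hσ : σ = 1 ∨ σ = -1) (a b : Fin 2 → ℝ) (ha : a 1 = σ * (r * a 0 + R))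
    (ha₁ : -1 < a 0) (ha₂ : a 0 < 1) (hb : b 0 = -1) (hb₁ : -(R - r) < b 1) (hb₂ : b 1 < R - r) :
    ∃ a' b' : Fin 2 → ℝ, a' ∈ trapKR r R ∧ b' ∈ trapKR r R ∧
      ∃ c : ℝ, 1 < c ∧ b' - a' = c • (b - a) := by
  have hg : 0 < R - r - σ * b 1 := by rcases hσ with rfl | rfl <;> linarith
  have hg' : 0 < R - r + σ * b 1 := by rcases hσ with rfl | rfl <;> linarith
  have hs : 0 < a 0 + 1 := by linarith
  obtain ⟨δ, hδ, hδ₁, hδ₂⟩ : ∃ δ : ℝ, 0 < δ ∧ δ * (a 0 + 1) ≤ 1 - a 0 ∧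
      δ * (R - r - σ * b 1) ≤ R - r + σ * b 1 :=
    ⟨min ((1 - a 0) / (a 0 + 1)) ((R - r + σ * b 1) / (R - r - σ * b 1)),
      lt_min (div_pos (by linarith) hs) (div_pos hg' hg),
      (le_div_iff₀ hs).1 (min_le_left _ _), (le_div_iff₀ hg).1 (min_le_right _ _)⟩
  have hδs : 0 < δ * (a 0 + 1) := mul_pos hδ hs
  have hδg : 0 < δ * (R - r - σ * b 1) := mul_pos hδ hg
  have hp : 0 < r * (a 0 + δ * (a 0 + 1) + 1) := mul_pos hr (by linarith)
  refine ⟨![a 0 + δ * (a 0 + 1), σ * (r * (a 0 + δ * (a 0 + 1)) + R)],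
    ![-1, b 1 - σ * (δ * (R - r - σ * b 1))], ?_, ?_, 1 + δ, by linarith, ?_⟩
  · simp only [trapKR, Set.mem_ofPred_eq, Matrix.cons_val_zero, Matrix.cons_val_one]
    rcases hσ with rfl | rfl <;> refine ⟨?_, ?_, ?_, ?_⟩ <;> linarith
  · simp only [trapKR, Set.mem_ofPred_eq, Matrix.cons_val_zero, Matrix.cons_val_one]
    rcases hσ with rfl | rfl <;> refine ⟨?_, ?_, ?_, ?_⟩ <;> linarith
  · ext i
    fin_cases i
    · simp [hb]
      ring
    · rcases hσ with rfl | rfl <;> simp [ha] <;> ring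

/-- a segment in the trapezoid `K` joining the interior of an oblique edge
to the interior of the left edge is not of maximal length among parallel chords of `K`:
there are `a', b' ∈ K` with `b' − a'` a positive multiple of `b − a`, `[a',b'] ⊆ K`, and
`‖b' − a'‖ > ‖b − a‖`. -/
theorem oblique_left_segment_not_maximal (r R : ℝ) (hr : 0 < r) (hrR : r < R)
    (a b : Fin 2 → ℝ) (hab : a ≠ b)
    (ha : (a 1 = r * a 0 + R ∧ -1 < a 0 ∧ a 0 < 1) ∨
          (a 1 = -(r * a 0 + R) ∧ -1 < a 0 ∧ a 0 < 1))
    (hb : b 0 = -1 ∧ -(R - r) < b 1 ∧ b 1 < R - r)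
    (hseg : segment ℝ a b ⊆ trapKR r R)
    (hbd : segment ℝ a b ∩ frontier (trapKR r R) ⊆ {a, b}) :
    ∃ a' b' : Fin 2 → ℝ, a' ∈ trapKR r R ∧ b' ∈ trapKR r R ∧
      (∃ c : ℝ, 0 < c ∧ b' - a' = c • (b - a)) ∧
      segment ℝ a' b' ⊆ trapKR r R ∧
      eucNorm2 (b - a) < eucNorm2 (b' - a') := by
  have key : ∃ a' b' : Fin 2 → ℝ, a' ∈ trapKR r R ∧ b' ∈ trapKR r R ∧
      ∃ c : ℝ, 1 < c ∧ b' - a' = c • (b - a) := by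
    obtain ⟨hb₀, hb₁, hb₂⟩ := hb
    rcases ha with ⟨ha, ha₁, ha₂⟩ | ⟨ha, ha₁, ha₂⟩
    · exact exists_longer_parallel_chord r R 1 hr hrR (.inl rfl) a b (by linarith) ha₁ ha₂
        hb₀ hb₁ hb₂
    · exact exists_longer_parallel_chord r R (-1) hr hrR (.inr rfl) a b (by linarith) ha₁ ha₂
        hb₀ hb₁ hb₂
  obtain ⟨a', b', ha', hb', c, hc, h⟩ := key
  have hx : (b - a) 0 ≠ 0 := by
    simp only [Pi.sub_apply, hb.1]
    rcases ha with ha | ha <;> exact ne_of_lt (by linarith [ha.2.1])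
  refine ⟨a', b', ha', hb', ⟨c, by linarith, h⟩, (convex_trapKR r R).segment_subset ha' hb', ?_⟩
  rw [h, eucNorm2_smul c (by linarith)]
  exact lt_mul_of_one_lt_left (eucNorm2_pos _ hx) hc
end

section
/- An ellipse inscribed in the trapezoid K that does not touch the right edge is not of maximal area among ellipses in K of the same direction and eccentricity: let A : ℝ² → ℝ² be an affine map with invertible linear part, let 𝓔 := A(D̄) ⊆ K where D̄ is the closed unit disk, let c := A(0) be its center, and suppose 𝓔 ∩ ∂K contains no point of the right edge {x ∈ ℝ² : x₁ = 1}. Then there exist ε > 0 and δ > 0 such that the translated and dilated ellipse {c + εe₁ + (1+δ)(x − c) : x ∈ 𝓔} is contained in K (where e₁ = (1,0)); this ellipse has the same direction and eccentricity as 𝓔 and strictly larger area. -/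
/-- The closed unit disk `D̄ ⊆ ℝ²` (for the Euclidean norm). -/
def closedUnitDisk : Set (Fin 2 → ℝ) := {x | (x 0) ^ 2 + (x 1) ^ 2 ≤ 1}

open MeasureTheory in
/-- Translating and dilating a set in the plane by a factor greater than `1` strictly increases
its area, provided this area is positive and finite. -/
theorem volume_lt_volume_image_translate_dilate {s : Set (Fin 2 → ℝ)} (h0 : volume s ≠ 0)
    (h1 : volume s ≠ ⊤) (c v : Fin 2 → ℝ) {δ : ℝ} (hδ : 0 < δ) :
    volume s < volume ((fun x : Fin 2 → ℝ => c + v + (1 + δ) • (x - c)) '' s) := by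
  have himage : (fun x : Fin 2 → ℝ => c + v + (1 + δ) • (x - c)) '' s =
      (fun x => v + x) '' (AffineMap.homothety c (1 + δ) '' s) := by
    rw [Set.image_image]
    congr 1
    ext x i
    simp [AffineMap.homothety_apply]
    ring
  rw [himage, Set.image_add_left, measure_preimage_add, Measure.addHaar_image_homothety]
  have hscale : (1 : ENNReal) < ENNReal.ofReal |(1 + δ) ^ Module.finrank ℝ (Fin 2 → ℝ)| := by
    rw [← ENNReal.ofReal_one]
    refine (ENNReal.ofReal_lt_ofReal_iff_of_nonneg zero_le_one).2 ?_
    rw [Module.finrank_fin_fun, abs_of_pos (by positivity)]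
    nlinarith
  simpa using ENNReal.mul_lt_mul_left h0 h1 hscale

theorem isCompact_closedUnitDisk : IsCompact closedUnitDisk := by
  have hclosed : IsClosed closedUnitDisk :=
    isClosed_le (f := fun x : Fin 2 → ℝ => x 0 ^ 2 + x 1 ^ 2) (by fun_prop) (by fun_prop)
  refine (isCompact_Icc (a := (-1 : Fin 2 → ℝ)) (b := 1)).of_isClosed_subset hclosed ?_
  intro x (hx : x 0 ^ 2 + x 1 ^ 2 ≤ 1)
  constructor <;> intro i <;> fin_cases i <;>
    simp only [Fin.zero_eta, Fin.mk_one, Pi.neg_apply, Pi.one_apply] <;>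
    nlinarith [sq_nonneg (x 0), sq_nonneg (x 1)]

theorem zero_mem_interior_closedUnitDisk : (0 : Fin 2 → ℝ) ∈ interior closedUnitDisk := by
  refine mem_interior.2 ⟨{x | x 0 ^ 2 + x 1 ^ 2 < 1}, ?_, ?_, by simp⟩
  · intro x (hx : x 0 ^ 2 + x 1 ^ 2 < 1)
    exact hx.le
  · exact isOpen_lt (by fun_prop) (by fun_prop)

open MeasureTheory in
theorem volume_image_closedUnitDisk_pos (A : (Fin 2 → ℝ) →ᵃ[ℝ] (Fin 2 → ℝ))
    (hA : Function.Surjective A.linear) : 0 < volume (A '' closedUnitDisk) := by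
  have hopen : IsOpenMap A :=
    A.isOpenMap_linear_iff.1 (A.linear.isOpenMap_of_finiteDimensional hA)
  have hpos := (hopen _ isOpen_interior).measure_pos volume
    ⟨A 0, Set.mem_image_of_mem A zero_mem_interior_closedUnitDisk⟩
  exact hpos.trans_le (measure_mono (Set.image_mono interior_subset))

/-- The points of the trapezoid on its right edge belong to its boundary. -/
theorem mem_frontier_trapKR {r R : ℝ} {x : Fin 2 → ℝ} (hx : x ∈ trapKR r R) (hx1 : x 0 = 1) :
    x ∈ frontier (trapKR r R) := by
  refine ⟨subset_closure hx, fun hint => ?_⟩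
  have hsub : trapKR r R ⊆ (fun y : Fin 2 → ℝ => y 0) ⁻¹' Set.Iic 1 := fun y hy => hy.2.1
  have hmem := interior_mono hsub hint
  rw [← IsOpenMap.preimage_interior_eq_interior_preimage (isOpenMap_eval 0) (continuous_apply 0),
    interior_Iic] at hmem
  exact absurd hx1 (ne_of_lt hmem)

/-- A subset of the trapezoid at horizontal distance at least `g` from the right edge can be moved
to the right by `g / 2` and dilated a bit inside the trapezoid. -/
theorem image_translate_dilate_subset_trapKR {r R g : ℝ} (hr : 0 < r) (hrR : r < R) (hg : 0 < g)
    {s : Set (Fin 2 → ℝ)} (hs : s ⊆ trapKR r R) (hgap : ∀ x ∈ s, x 0 ≤ 1 - g)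
    {c : Fin 2 → ℝ} (hc : c ∈ trapKR r R) :
    (fun x : Fin 2 → ℝ => c + (g / 2) • ![1, 0] +
      (1 + g / 2 * r / (2 * (r + R))) • (x - c)) '' s ⊆ trapKR r R := by
  rintro _ ⟨x, hxs, rfl⟩
  obtain ⟨hx1, hx2, hx3, hx4⟩ := hs hxs
  have hxg := hgap x hxs
  obtain ⟨hc1, hc2, hc3, hc4⟩ := hc
  set δ := g / 2 * r / (2 * (r + R)) with hδ_def
  have hδ : 0 < δ := by
    have : 0 < r + R := by linarith
    positivity
  have hδr : δ * (2 * (r + R)) = r * (g / 2) := by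
    rw [hδ_def]
    field_simp [show r + R ≠ 0 by linarith]
  have hδg : 4 * δ ≤ g / 2 := by
    by_contra! h
    nlinarith
  have hrc : r * c 0 ≤ r := by nlinarith
  have htop : δ * (r * c 0 + R - c 1) ≤ r * (g / 2) := by
    rw [← hδr]
    gcongr
    linarith
  have hbot : δ * (r * c 0 + R + c 1) ≤ r * (g / 2) := by
    rw [← hδr]
    gcongr
    linarith
  simp only [trapKR, Set.mem_ofPred_eq, Pi.add_apply, Pi.smul_apply, Pi.sub_apply, smul_eq_mul,
    Matrix.cons_val_zero, Matrix.cons_val_one]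
  refine ⟨?_, ?_, ?_, ?_⟩
  · nlinarith
  · nlinarith
  · nlinarith [mul_nonneg hδ.le (show 0 ≤ r * x 0 + R + x 1 by linarith)]
  · nlinarith [mul_nonneg hδ.le (show 0 ≤ r * x 0 + R - x 1 by linarith)]

/-- an ellipse `𝓔 = A(D̄) ⊆ K` (with `A` affine with invertible linear part,
center `c = A(0)`) whose intersection with `∂K` contains no point of the right edge
`{x₁ = 1}` is not maximal: for some `ε, δ > 0` the translated and dilated ellipse
`{c + εe₁ + (1+δ)(x − c) : x ∈ 𝓔}` is still contained in `K` (and it has the same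
direction and eccentricity as `𝓔` and strictly larger area). -/
theorem ellipse_missing_right_edge_not_maximal (r R : ℝ) (hr : 0 < r) (hrR : r < R)
    (A : (Fin 2 → ℝ) →ᵃ[ℝ] (Fin 2 → ℝ)) (hA : Function.Bijective A.linear)
    (hsub : A '' closedUnitDisk ⊆ trapKR r R)
    (hedge : ∀ x ∈ (A '' closedUnitDisk) ∩ frontier (trapKR r R), x 0 ≠ 1) :
    ∃ ε > (0 : ℝ), ∃ δ > (0 : ℝ),
      (fun x : Fin 2 → ℝ => A 0 + ε • ![1, 0] + (1 + δ) • (x - A 0)) ''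
          (A '' closedUnitDisk) ⊆ trapKR r R ∧
      MeasureTheory.volume (A '' closedUnitDisk) <
        MeasureTheory.volume
          ((fun x : Fin 2 → ℝ => A 0 + ε • ![1, 0] + (1 + δ) • (x - A 0)) ''
            (A '' closedUnitDisk)) := by
  have hcompact : IsCompact (A '' closedUnitDisk) :=
    isCompact_closedUnitDisk.image A.continuous_of_finiteDimensional
  have hcenter : A 0 ∈ A '' closedUnitDisk :=
    Set.mem_image_of_mem A (interior_subset zero_mem_interior_closedUnitDisk)
  obtain ⟨p, hp, hmax⟩ :=
    hcompact.exists_isMaxOn ⟨A 0, hcenter⟩ (continuous_apply (0 : Fin 2)).continuousOn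
  have hp1 : p 0 < 1 :=
    lt_of_le_of_ne (hsub hp).2.1 fun h => hedge p ⟨hp, mem_frontier_trapKR (hsub hp) h⟩ h
  have hg : 0 < 1 - p 0 := by linarith
  have hδ : 0 < (1 - p 0) / 2 * r / (2 * (r + R)) := by
    have : 0 < r + R := by linarith
    positivity
  refine ⟨(1 - p 0) / 2, half_pos hg, _, hδ, ?_, ?_⟩
  · exact image_translate_dilate_subset_trapKR hr hrR hg hsub
      (fun x hx => by simpa using hmax hx) (hsub hcenter)
  · exact volume_lt_volume_image_translate_dilate
      (volume_image_closedUnitDisk_pos A hA.2).ne' hcompact.measure_ne_top _ _ hδ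
end
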